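/- arXiv:1910.01931 — 2 statements merged into one kernel-verified Lean document; each statement's English description precedes it below -/
import Mathlib

section
/- Let A = P + Ξ with A, P, Ξ ∈ ℝ^{n×m}, and let J = J₁ × J₂ with J₁ ⊆ {1,…,n}, J₂ ⊆ {1,…,m}. Let û ∈ ℝ^n, v̂ ∈ ℝ^m be unit vectors supported on J₁ and J₂ respectively with ⟨û, Π_J(A) v̂⟩ = ‖Π_J(A)‖_op, and let u ∈ ℝ^n, v ∈ ℝ^m be unit vectors supported on J₁ and J₂ respectively with ⟨u, Π_J(P) v⟩ = ‖Π_J(P)‖_op. Then ‖Π_{u,v}(Π_J(P)) − P‖_F ≤ ‖Π_{û,v̂}(Π_J(P)) − P‖_F ≤ ‖Π_{û,v̂}(Π_J(A)) − P‖_F. -/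
open scoped BigOperators

/-- Rank-one projection `Π_{u,v}(X) = (u uᵀ) X (v vᵀ)`. -/
noncomputable def rankOneProj {n m : ℕ} (u : Fin n → ℝ) (v : Fin m → ℝ)
    (X : Matrix (Fin n) (Fin m) ℝ) : Matrix (Fin n) (Fin m) ℝ :=
  fun i j => u i * (∑ a, ∑ b, u a * X a b * v b) * v j

/-- Projection onto matrices supported on `J₁ × J₂`. -/
def suppProj {n m : ℕ} (J₁ : Finset (Fin n)) (J₂ : Finset (Fin m))
    (X : Matrix (Fin n) (Fin m) ℝ) : Matrix (Fin n) (Fin m) ℝ :=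
  fun i j => if i ∈ J₁ ∧ j ∈ J₂ then X i j else 0

/-- Frobenius norm of a real matrix. -/
noncomputable def frobNorm {n m : ℕ} (X : Matrix (Fin n) (Fin m) ℝ) : ℝ :=
  Real.sqrt (∑ i, ∑ j, X i j ^ 2)

/-- Spectral (operator) norm of a real matrix. -/
noncomputable def opNorm {n m : ℕ} (X : Matrix (Fin n) (Fin m) ℝ) : ℝ :=
  ‖LinearMap.toContinuousLinearMap (Matrix.toEuclideanLin X)‖

theorem abs_bilin_le_opNorm {n m : ℕ} (X : Matrix (Fin n) (Fin m) ℝ) (u : Fin n → ℝ)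
    (v : Fin m → ℝ) (hu : ∑ i, u i ^ 2 = 1) (hv : ∑ j, v j ^ 2 = 1) :
    |∑ i, ∑ j, u i * X i j * v j| ≤ opNorm X := by
  have hu' : ‖WithLp.toLp 2 u‖ = 1 := by simp [EuclideanSpace.norm_eq, hu]
  have hv' : ‖WithLp.toLp 2 v‖ = 1 := by simp [EuclideanSpace.norm_eq, hv]
  have h_apply := (LinearMap.toContinuousLinearMap (Matrix.toEuclideanLin X)).le_opNorm
    (WithLp.toLp 2 v)
  have h_inner := abs_real_inner_le_norm (WithLp.toLp 2 u)
    (LinearMap.toContinuousLinearMap (Matrix.toEuclideanLin X) (WithLp.toLp 2 v))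
  have h_eq : inner ℝ (WithLp.toLp 2 u)
      (LinearMap.toContinuousLinearMap (Matrix.toEuclideanLin X) (WithLp.toLp 2 v)) =
      ∑ i, ∑ j, u i * X i j * v j := by
    simp only [PiLp.inner_apply, LinearMap.coe_toContinuousLinearMap',
      Matrix.toLpLin_toLp, Matrix.toLin'_apply, Matrix.mulVec, dotProduct, Real.inner_apply, Finset.mul_sum,
      mul_assoc]
  rw [hv', mul_one] at h_apply
  rw [hu', one_mul, h_eq] at h_inner
  exact h_inner.trans h_apply

theorem bilin_suppProj {n m : ℕ} (J₁ : Finset (Fin n)) (J₂ : Finset (Fin m))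
    (X : Matrix (Fin n) (Fin m) ℝ) (u : Fin n → ℝ) (v : Fin m → ℝ)
    (hu : ∀ i, i ∉ J₁ → u i = 0) (hv : ∀ j, j ∉ J₂ → v j = 0) :
    ∑ i, ∑ j, u i * suppProj J₁ J₂ X i j * v j = ∑ i, ∑ j, u i * X i j * v j := by
  refine Finset.sum_congr rfl fun i _ => Finset.sum_congr rfl fun j _ => ?_
  by_cases hi : i ∈ J₁
  · by_cases hj : j ∈ J₂
    · simp [suppProj, hi, hj]
    · simp [hv j hj]
  · simp [hu i hi]

theorem sum_sq_rankOneProj_sub {n m : ℕ} (X P : Matrix (Fin n) (Fin m) ℝ) (u : Fin n → ℝ)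
    (v : Fin m → ℝ) (hu : ∑ i, u i ^ 2 = 1) (hv : ∑ j, v j ^ 2 = 1) :
    ∑ i, ∑ j, (rankOneProj u v X - P) i j ^ 2 =
      (∑ i, ∑ j, u i * X i j * v j) ^ 2 -
        2 * (∑ i, ∑ j, u i * X i j * v j) * (∑ i, ∑ j, u i * P i j * v j) +
        ∑ i, ∑ j, P i j ^ 2 := by
  simp only [Matrix.sub_apply, rankOneProj]
  generalize ∑ i, ∑ j, u i * X i j * v j = c
  calc ∑ i, ∑ j, (u i * c * v j - P i j) ^ 2
      = ∑ i, ∑ j, (c ^ 2 * (u i ^ 2 * v j ^ 2) - 2 * c * (u i * P i j * v j) + P i j ^ 2) :=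
        Finset.sum_congr rfl fun i _ => Finset.sum_congr rfl fun j _ => by ring
    _ = _ := by
        simp only [Finset.sum_add_distrib, Finset.sum_sub_distrib, ← Finset.mul_sum, hv, hu,
          mul_one]

/-- Lemma on the projection of `A = P + Ξ`: if `(û, v̂)` are top singular vectors of
`Π_J(A)` and `(u, v)` are top singular vectors of `Π_J(P)`, all supported on `J`, then
`‖Π_{u,v}(Π_J(P)) − P‖_F ≤ ‖Π_{û,v̂}(Π_J(P)) − P‖_F ≤ ‖Π_{û,v̂}(Π_J(A)) − P‖_F`. -/
theorem stmt2 {n m : ℕ} (A P Ξ : Matrix (Fin n) (Fin m) ℝ) (hA : A = P + Ξ)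
    (J₁ : Finset (Fin n)) (J₂ : Finset (Fin m))
    (hu hv : Fin n → ℝ) -- û and u
    (vu vv : Fin m → ℝ) -- v̂ and v
    (hhu : ∑ i, hu i ^ 2 = 1) (hvu : ∑ j, vu j ^ 2 = 1)
    (hhv : ∑ i, hv i ^ 2 = 1) (hvv : ∑ j, vv j ^ 2 = 1)
    (hsupp_hu : ∀ i, i ∉ J₁ → hu i = 0) (hsupp_vu : ∀ j, j ∉ J₂ → vu j = 0)
    (hsupp_hv : ∀ i, i ∉ J₁ → hv i = 0) (hsupp_vv : ∀ j, j ∉ J₂ → vv j = 0)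
    (hsingA : ∑ i, ∑ j, hu i * suppProj J₁ J₂ A i j * vu j = opNorm (suppProj J₁ J₂ A))
    (hsingP : ∑ i, ∑ j, hv i * suppProj J₁ J₂ P i j * vv j = opNorm (suppProj J₁ J₂ P)) :
    frobNorm (rankOneProj hv vv (suppProj J₁ J₂ P) - P) ≤
        frobNorm (rankOneProj hu vu (suppProj J₁ J₂ P) - P) ∧
      frobNorm (rankOneProj hu vu (suppProj J₁ J₂ P) - P) ≤
        frobNorm (rankOneProj hu vu (suppProj J₁ J₂ A) - P) := by
  have h_sq : (∑ i, ∑ j, hu i * P i j * vu j) ^ 2 ≤ (∑ i, ∑ j, hv i * P i j * vv j) ^ 2 := by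
    have h_le := abs_bilin_le_opNorm (suppProj J₁ J₂ P) hu vu hhu hvu
    rw [← hsingP, bilin_suppProj J₁ J₂ P hu vu hsupp_hu hsupp_vu,
      bilin_suppProj J₁ J₂ P hv vv hsupp_hv hsupp_vv] at h_le
    exact sq_le_sq' (abs_le.mp h_le).1 (abs_le.mp h_le).2
  refine ⟨Real.sqrt_le_sqrt ?_, Real.sqrt_le_sqrt ?_⟩
  · rw [sum_sq_rankOneProj_sub _ P hv vv hhv hvv, sum_sq_rankOneProj_sub _ P hu vu hhu hvu,
      bilin_suppProj J₁ J₂ P hu vu hsupp_hu hsupp_vu,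
      bilin_suppProj J₁ J₂ P hv vv hsupp_hv hsupp_vv]
    linarith
  · rw [sum_sq_rankOneProj_sub _ P hu vu hhu hvu, sum_sq_rankOneProj_sub _ P hu vu hhu hvu,
      bilin_suppProj J₁ J₂ P hu vu hsupp_hu hsupp_vu]
    linarith [sq_nonneg ((∑ i, ∑ j, hu i * suppProj J₁ J₂ A i j * vu j) -
      ∑ i, ∑ j, hu i * P i j * vu j)]
end

section
/- Let A ∈ {0,1}^{n×n} be symmetric, let K ≥ 1, let c : {1,…,n} → {1,…,K} be a community assignment with all communities nonempty, and for k, l ∈ {1,…,K} let A^{(k,l)} denote the submatrix of A with rows in community k and columns in community l. Define the data support J̆_{k,l} = {i in community k : row i of A^{(k,l)} has a nonzero entry}. For a family J = (J_{k,l})_{k,l} with J_{k,l} a subset of community k, define the fit f(J) = ∑_{k,l=1}^K min{‖A^{(k,l)} − R‖_F² : R of rank at most 1 supported on J_{k,l} × J_{l,k}}, and consider minimizing f(J) + Pen(J) over all such families J, where Pen(J) is a strictly increasing function of the total cardinality |J| = ∑_{k,l} |J_{k,l}| (or, respectively, strictly increasing in each |J_{k,l}|). Then every minimizer Ĵ satisfies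 Ĵ_{k,l} ⊆ J̆_{k,l} for all k, l. Moreover, if P ∈ [0,1]^{n×n} is a symmetric matrix such that A_{ij} = 0 whenever P_{ij} = 0, and J̆*_{k,l} = {i in community k : row i of P^{(k,l)} has a nonzero entry}, then J̆_{k,l} ⊆ J̆*_{k,l} for all k, l. -/
open scoped BigOperators

/-- The fit `f(J) = ∑_{k,l} min{‖A^{(k,l)} − R‖_F² : rank R ≤ 1, R supported on J_{k,l}×J_{l,k}}`,
where `A^{(k,l)}` is the submatrix of `A` with rows in community `k` and columns in
community `l`. -/
noncomputable def blockFit {n K : ℕ} (A : Matrix (Fin n) (Fin n) ℝ) (c : Fin n → Fin K)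
    (J : Fin K → Fin K → Finset (Fin n)) : ℝ :=
  ∑ k, ∑ l,
    sInf { t : ℝ | ∃ R : Matrix {i // c i = k} {j // c j = l} ℝ,
      R.rank ≤ 1 ∧
      (∀ (i : {i // c i = k}) (j : {j // c j = l}),
        (i.1 ∉ J k l ∨ j.1 ∉ J l k) → R i j = 0) ∧
      t = ∑ i, ∑ j, (A i.1 j.1 - R i j) ^ 2 }

/-- The data support `J̆_{k,l} = {i in community k : row i of A^{(k,l)} has a nonzero entry}`. -/
def dataSupport {n K : ℕ} (A : Matrix (Fin n) (Fin n) ℝ) (c : Fin n → Fin K)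
    (k l : Fin K) : Set (Fin n) :=
  { i | c i = k ∧ ∃ j, c j = l ∧ A i j ≠ 0 }

/-- Restricting every `J k l` to the data support does not increase the fit. -/
theorem blockFit_restrict_le {n K : ℕ} (A : Matrix (Fin n) (Fin n) ℝ)
    (hAsym : ∀ i j, A i j = A j i) (c : Fin n → Fin K)
    (J J' : Fin K → Fin K → Finset (Fin n))
    (hJ' : ∀ k l i, i ∈ J' k l ↔ i ∈ J k l ∧ i ∈ dataSupport A c k l) :
    blockFit A c J' ≤ blockFit A c J := by
  classical
  refine Finset.sum_le_sum fun k _ => Finset.sum_le_sum fun l _ => ?_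
  refine le_csInf ⟨_, 0, by simp, fun _ _ _ => rfl, rfl⟩ ?_
  rintro t ⟨R, hrank, hsupp, rfl⟩
  let d : {i // c i = k} → ℝ := fun i => if i.1 ∈ dataSupport A c k l then 1 else 0
  let e : {j // c j = l} → ℝ := fun j => if j.1 ∈ dataSupport A c l k then 1 else 0
  have hentry (i : {i // c i = k}) (j : {j // c j = l}) :
      (Matrix.diagonal d * R * Matrix.diagonal e) i j = d i * R i j * e j := by
    rw [Matrix.mul_diagonal, Matrix.diagonal_mul]
  refine csInf_le_of_le ⟨0, ?_⟩
    ⟨Matrix.diagonal d * R * Matrix.diagonal e, ?_, fun i j hij => ?_, rfl⟩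
    (Finset.sum_le_sum fun i _ => Finset.sum_le_sum fun j _ => ?_)
  · rintro t ⟨R, -, -, rfl⟩
    positivity
  · exact (Matrix.rank_mul_le_left _ _).trans ((Matrix.rank_mul_le_right _ _).trans hrank)
  · rw [hentry]
    by_cases hi : i.1 ∈ dataSupport A c k l
    · by_cases hj : j.1 ∈ dataSupport A c l k
      · rw [hsupp i j (by simpa [hJ', hi, hj] using hij)]
        simp
      · simp [e, hj]
    · simp [d, hi]
  · rw [hentry]
    by_cases hi : i.1 ∈ dataSupport A c k l
    · by_cases hj : j.1 ∈ dataSupport A c l k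
      · simp [d, e, hi, hj]
      · have h0 : A i.1 j.1 = 0 := by
          by_contra h
          exact hj ⟨j.2, i.1, i.2, hAsym i.1 j.1 ▸ h⟩
        simpa [e, hj, h0] using sq_nonneg (R i j)
    · have h0 : A i.1 j.1 = 0 := by
        by_contra h
        exact hi ⟨i.2, j.1, j.2, h⟩
      simpa [d, hi, h0] using sq_nonneg (R i j)

/-- Any minimizer `Ĵ` of `f(J) + Pen(J)` with `Pen` strictly increasing in the total
cardinality `|J|` (or, respectively, in each `|J_{k,l}|`) satisfies `Ĵ_{k,l} ⊆ J̆_{k,l}`;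
moreover, if `A_{ij} = 0` whenever `P_{ij} = 0`, then `J̆_{k,l} ⊆ J̆*_{k,l}`. -/
theorem stmt9 {n K : ℕ} (hK : 1 ≤ K)
    (A : Matrix (Fin n) (Fin n) ℝ)
    (hA01 : ∀ i j, A i j = 0 ∨ A i j = 1) (hAsym : ∀ i j, A i j = A j i)
    (c : Fin n → Fin K) (hc : Function.Surjective c)
    (Pen : (Fin K → Fin K → Finset (Fin n)) → ℝ)
    (hPen :
      (∃ g : ℕ → ℝ, StrictMono g ∧
          ∀ J : Fin K → Fin K → Finset (Fin n), Pen J = g (∑ k, ∑ l, (J k l).card)) ∨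
      (∃ g : (Fin K → Fin K → ℕ) → ℝ,
          (∀ J : Fin K → Fin K → Finset (Fin n), Pen J = g (fun k l => (J k l).card)) ∧
          ∀ m m' : Fin K → Fin K → ℕ, (∀ k l, m k l ≤ m' k l) → m ≠ m' → g m < g m'))
    (Jhat : Fin K → Fin K → Finset (Fin n))
    (hJhat : ∀ k l, ∀ i ∈ Jhat k l, c i = k)
    (hmin : ∀ J' : Fin K → Fin K → Finset (Fin n), (∀ k l, ∀ i ∈ J' k l, c i = k) →
      blockFit A c Jhat + Pen Jhat ≤ blockFit A c J' + Pen J')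
    (P : Matrix (Fin n) (Fin n) ℝ)
    (hP : ∀ i j, 0 ≤ P i j ∧ P i j ≤ 1) (hPsym : ∀ i j, P i j = P j i)
    (hAP : ∀ i j, P i j = 0 → A i j = 0) :
    (∀ k l, ↑(Jhat k l) ⊆ dataSupport A c k l) ∧
      (∀ k l, dataSupport A c k l ⊆ dataSupport P c k l) := by
  classical
  refine ⟨fun k l i hi => ?_, fun k l i ⟨hik, j, hjl, hj⟩ =>
    ⟨hik, j, hjl, fun h => hj (hAP i j h)⟩⟩
  by_contra hid
  let J' : Fin K → Fin K → Finset (Fin n) :=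
    fun k l => (Jhat k l).filter (· ∈ dataSupport A c k l)
  have hfit : blockFit A c J' ≤ blockFit A c Jhat :=
    blockFit_restrict_le A hAsym c Jhat J' fun _ _ _ => Finset.mem_filter
  have hle (a b : Fin K) : (J' a b).card ≤ (Jhat a b).card :=
    Finset.card_le_card (Finset.filter_subset _ _)
  have hlt : (J' k l).card < (Jhat k l).card :=
    Finset.card_lt_card (Finset.filter_ssubset.2 ⟨i, hi, hid⟩)
  have hPenlt : Pen J' < Pen Jhat := by
    rcases hPen with ⟨g, hg, hPen⟩ | ⟨g, hPen, hg⟩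
    · rw [hPen, hPen]
      refine hg (Finset.sum_lt_sum (fun a _ => Finset.sum_le_sum fun b _ => hle a b)
        ⟨k, Finset.mem_univ k, Finset.sum_lt_sum (fun b _ => hle k b)
          ⟨l, Finset.mem_univ l, hlt⟩⟩)
    · rw [hPen, hPen]
      exact hg _ _ hle fun h => hlt.ne (congrFun (congrFun h k) l)
  have hm := hmin J' fun a b x hx => hJhat a b x (Finset.mem_filter.1 hx).1
  linarith
end
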